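/- arXiv:1403.0622 — 3 statements merged into one kernel-verified Lean document; each statement's English description precedes it below -/
import Mathlib

section
/- Let κ ≥ 5 and let G be a κ-deletion-minimal graph with respect to total coloring. Then the subgraph of G induced by the set of edges incident with vertices of degree 2 contains no cycle (it is a forest). -/
open SimpleGraph

variable {V : Type*}

/-- The degree of a vertex, defined via the cardinality of its neighbor set. -/
noncomputable def deg (G : SimpleGraph V) (v : V) : ℕ := (G.neighborSet v).ncard

/-- The maximum degree of a graph. -/
noncomputable def maxDeg (G : SimpleGraph V) : ℕ := ⨆ v, deg G v

/-- `fv` colors the vertices and `fe` colors the edges; together they form a total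
coloring: adjacent vertices get distinct colors, distinct edges sharing a vertex get
distinct colors, and a vertex gets a color distinct from every edge incident to it. -/
def IsTotalColoring (G : SimpleGraph V) {α : Type*} (fv : V → α) (fe : Sym2 V → α) : Prop :=
  (∀ u v : V, G.Adj u v → fv u ≠ fv v) ∧
  (∀ e₁ e₂ : Sym2 V, e₁ ∈ G.edgeSet → e₂ ∈ G.edgeSet → e₁ ≠ e₂ →
      (∃ w : V, w ∈ e₁ ∧ w ∈ e₂) → fe e₁ ≠ fe e₂) ∧
  (∀ (v : V) (e : Sym2 V), e ∈ G.edgeSet → v ∈ e → fv v ≠ fe e)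

/-- `G` has a total coloring with `n` colors. -/
def HasTotalColoring (G : SimpleGraph V) (n : ℕ) : Prop :=
  ∃ (fv : V → Fin n) (fe : Sym2 V → Fin n), IsTotalColoring G fv fe

/-- The total chromatic number of `G`. -/
noncomputable def totalChromaticNumber (G : SimpleGraph V) : ℕ :=
  sInf {n | HasTotalColoring G n}

/-- A `κ`-deletion-minimal graph: maximum degree at most `κ - 1`, total chromatic
number greater than `κ`, but every proper subgraph has total chromatic number at most `κ`. -/
def DeletionMinimal (κ : ℕ) (G : SimpleGraph V) : Prop :=
  (∀ v : V, deg G v ≤ κ - 1) ∧ κ < totalChromaticNumber G ∧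
  ∀ H : SimpleGraph V, H < G → totalChromaticNumber H ≤ κ

namespace TotalColoring

/-- The edges at `x` receive pairwise distinct colors. -/
def EdgeProperAt (G : SimpleGraph V) {α : Type*} (fe : Sym2 V → α) (x : V) : Prop :=
  ∀ y z, G.Adj x y → G.Adj x z → y ≠ z → fe s(x, y) ≠ fe s(x, z)

/-- The constraints involving vertex colors hold at the vertices whose degree is not `2`. -/
def VertexProperOffTwo (G : SimpleGraph V) {α : Type*} (fv : V → α) (fe : Sym2 V → α) : Prop :=
  (∀ u v, G.Adj u v → deg G u ≠ 2 → deg G v ≠ 2 → fv u ≠ fv v) ∧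
  ∀ u v, G.Adj u v → deg G u ≠ 2 → fv u ≠ fe s(u, v)

theorem exists_fresh {n : ℕ} (S : Finset (Fin n)) (h : S.card < n) : ∃ c, c ∉ S := by
  by_contra! hS
  rw [Finset.eq_univ_iff_forall.mpr hS, Finset.card_univ, Fintype.card_fin] at h
  exact h.false

theorem IsTotalColoring.edgeProperAt {G : SimpleGraph V} {α : Type*} {fv : V → α}
    {fe : Sym2 V → α} (h : IsTotalColoring G fv fe) (x : V) : EdgeProperAt G fe x := by
  intro y z hy hz hyz
  exact h.2.1 _ _ hy hz (by rwa [Ne, Sym2.congr_right]) ⟨x, by simp, by simp⟩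

theorem isTotalColoring_of_edgeProperAt {G : SimpleGraph V} {α : Type*} {fv : V → α}
    {fe : Sym2 V → α} (h₁ : ∀ u v, G.Adj u v → fv u ≠ fv v) (h₂ : ∀ x, EdgeProperAt G fe x)
    (h₃ : ∀ u v, G.Adj u v → fv u ≠ fe s(u, v)) : IsTotalColoring G fv fe := by
  refine ⟨h₁, ?_, ?_⟩
  · rintro e₁ e₂ he₁ he₂ hne ⟨x, hx₁, hx₂⟩
    obtain ⟨y, rfl⟩ := hx₁
    obtain ⟨z, rfl⟩ := hx₂
    exact h₂ x y z he₁ he₂ (by rintro rfl; exact hne rfl)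
  · rintro v e he ⟨w, rfl⟩
    exact h₃ v w he

theorem hasTotalColoring_mono {G : SimpleGraph V} {m n : ℕ} (hmn : m ≤ n)
    (h : HasTotalColoring G m) : HasTotalColoring G n := by
  obtain ⟨fv, fe, h₁, h₂, h₃⟩ := h
  refine ⟨fun v => Fin.castLE hmn (fv v), fun e => Fin.castLE hmn (fe e), ?_, ?_, ?_⟩
  · intro u v huv h
    exact h₁ u v huv (Fin.castLE_injective hmn h)
  · intro e₁ e₂ he₁ he₂ hne hw h
    exact h₂ e₁ e₂ he₁ he₂ hne hw (Fin.castLE_injective hmn h)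
  · intro v e he hv h
    exact h₃ v e he hv (Fin.castLE_injective hmn h)

theorem exists_hasTotalColoring [Fintype V] (G : SimpleGraph V) :
    ∃ n, HasTotalColoring G n := by
  classical
  let f : V ⊕ Sym2 V ≃ Fin (Fintype.card (V ⊕ Sym2 V)) := Fintype.equivFin _
  refine ⟨_, fun v => f (.inl v), fun e => f (.inr e), ?_, ?_, ?_⟩
  · intro u v huv h
    exact huv.ne (by simpa using h)
  · intro e₁ e₂ _ _ hne _ h
    exact hne (by simpa using h)
  · intro v e _ _ h
    simp at h

theorem hasTotalColoring_iff_totalChromaticNumber_le [Fintype V] (G : SimpleGraph V) (n : ℕ) :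
    HasTotalColoring G n ↔ totalChromaticNumber G ≤ n :=
  ⟨fun h => Nat.sInf_le h,
    fun h => hasTotalColoring_mono h (Nat.sInf_mem (exists_hasTotalColoring G))⟩

theorem exists_other_neighbor {G : SimpleGraph V} {u v : V} (h : deg G u = 2)
    (huv : G.Adj u v) : ∃ x, x ≠ v ∧ G.Adj u x ∧ ∀ z, G.Adj u z → z = v ∨ z = x := by
  obtain ⟨a, b, hab, hs⟩ := Set.ncard_eq_two.mp h
  have hz : ∀ z, G.Adj u z ↔ z = a ∨ z = b := fun z => by
    rw [← mem_neighborSet, hs]; simp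
  rcases (hz v).mp huv with rfl | rfl
  · exact ⟨b, hab.symm, (hz b).mpr (.inr rfl), fun z h => (hz z).mp h⟩
  · exact ⟨a, hab, (hz a).mpr (.inl rfl), fun z h => ((hz z).mp h).symm⟩

theorem edgeProperAt_of_other {G : SimpleGraph V} {α : Type*} {fe : Sym2 V → α} {u v x : V}
    (hz : ∀ z, G.Adj u z → z = v ∨ z = x) (h : fe s(u, v) ≠ fe s(u, x)) :
    EdgeProperAt G fe u := by
  intro y z hy hz' hyz
  rcases hz y hy with rfl | rfl <;> rcases hz z hz' with rfl | rfl
  · exact absurd rfl hyz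
  · exact h
  · exact h.symm
  · exact absurd rfl hyz

/-- Vertices of degree `2` that are pairwise nonadjacent can be colored last. -/
theorem hasTotalColoring_of_off_two {G : SimpleGraph V} {κ : ℕ} (hκ : 5 ≤ κ)
    (hind : ∀ u v, G.Adj u v → deg G u = 2 → deg G v ≠ 2) {fv : V → Fin κ}
    {fe : Sym2 V → Fin κ} (h : VertexProperOffTwo G fv fe) (he : ∀ x, EdgeProperAt G fe x) :
    HasTotalColoring G κ := by
  classical
  have key : ∀ u, ∃ c, deg G u = 2 → ∀ v, G.Adj u v → c ≠ fv v ∧ c ≠ fe s(u, v) := by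
    intro u
    by_cases hu : deg G u = 2
    · obtain ⟨a, b, hab, hs⟩ := Set.ncard_eq_two.mp hu
      obtain ⟨c, hc⟩ := exists_fresh {fv a, fv b, fe s(u, a), fe s(u, b)}
        (Finset.card_le_four.trans_lt hκ)
      simp only [Finset.mem_insert, Finset.mem_singleton, not_or] at hc
      refine ⟨c, fun _ v hv => ?_⟩
      have : v = a ∨ v = b := by rw [← mem_neighborSet, hs] at hv; simpa using hv
      rcases this with rfl | rfl
      · exact ⟨hc.1, hc.2.2.1⟩
      · exact ⟨hc.2.1, hc.2.2.2⟩
    · exact ⟨fv u, fun h => absurd h hu⟩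
  choose g hg using key
  refine ⟨fun u => if deg G u = 2 then g u else fv u, fe,
    isTotalColoring_of_edgeProperAt ?_ he ?_⟩
  · intro u v huv
    by_cases hu : deg G u = 2
    · simpa [hu, hind u v huv hu] using (hg u hu v huv).1
    · by_cases hv : deg G v = 2
      · simpa [hu, hv] using (hg v hv u huv.symm).1.symm
      · simpa [hu, hv] using h.1 u v huv hu hv
  · intro u v huv
    by_cases hu : deg G u = 2
    · simpa [hu] using (hg u hu v huv).2
    · simpa [hu] using h.2 u v huv hu

/-- Interchanging the colors of two edges `xw` and `xw'`, where all edges at `w` have color `c`,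
moves the conflict at `w` to a conflict at `w'`. -/
theorem exists_swap {G : SimpleGraph V} {α : Type*} {fv : V → α} {fe : Sym2 V → α}
    {w x w' : V} {c : α} (hw : deg G w = 2) (hw' : deg G w' = 2) (hxw : G.Adj x w)
    (hxw' : G.Adj x w') (hne : w ≠ w') (h : VertexProperOffTwo G fv fe)
    (he : ∀ y, y ≠ w → EdgeProperAt G fe y) (hc : ∀ y, G.Adj w y → fe s(w, y) = c) :
    ∃ fe' : Sym2 V → α, VertexProperOffTwo G fv fe' ∧ (∀ y, y ≠ w' → EdgeProperAt G fe' y) ∧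
      fe' s(x, w') = c ∧ ∀ e, e ≠ s(x, w) → e ≠ s(x, w') → fe' e = fe e := by
  classical
  let fe' : Sym2 V → α := fun e => fe (Equiv.swap s(x, w) s(x, w') e)
  have hoff : ∀ e, e ≠ s(x, w) → e ≠ s(x, w') → fe' e = fe e := fun e h₁ h₂ => by
    simp only [fe', Equiv.swap_apply_of_ne_of_ne h₁ h₂]
  have hfw : fe' s(x, w) = fe s(x, w') := by simp [fe']
  have hfw' : fe' s(x, w') = fe s(x, w) := by simp [fe']
  have hfx : ∀ y, fe' s(x, y) = fe s(x, Equiv.swap w w' y) := by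
    intro y
    by_cases hy : y = w
    · subst hy; simpa using hfw
    by_cases hy' : y = w'
    · subst hy'; simpa using hfw'
    rw [hoff _ (by rwa [Ne, Sym2.congr_right]) (by rwa [Ne, Sym2.congr_right]),
      Equiv.swap_apply_of_ne_of_ne hy hy']
  have hadj : ∀ y, G.Adj x y → G.Adj x (Equiv.swap w w' y) := by
    intro y hy
    by_cases h₁ : y = w
    · subst h₁; simpa
    by_cases h₂ : y = w'
    · subst h₂; simpa
    rwa [Equiv.swap_apply_of_ne_of_ne h₁ h₂]
  have hfar : ∀ y z, y ≠ x → y ≠ w → y ≠ w' → fe' s(y, z) = fe s(y, z) := by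
    intro y z h₁ h₂ h₃
    apply hoff <;> simp [h₁, h₂, h₃]
  have hwc : fe s(x, w) = c := by rw [Sym2.eq_swap]; exact hc x hxw.symm
  refine ⟨fe', ⟨h.1, ?_⟩, ?_, hfw'.trans hwc, hoff⟩
  · intro u v huv hu
    by_cases hux : u = x
    · subst hux
      rw [hfx]
      exact h.2 _ _ (hadj v huv) hu
    · rw [hfar u v hux (by rintro rfl; exact hu hw) (by rintro rfl; exact hu hw')]
      exact h.2 _ _ huv hu
  · intro y hyw'
    by_cases hyx : y = x
    · subst hyx
      intro a b ha hb hab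
      rw [hfx, hfx]
      exact he y hxw.ne _ _ (hadj a ha) (hadj b hb) ((Equiv.swap w w').injective.ne hab)
    by_cases hyw : y = w
    · subst hyw
      obtain ⟨z, hzx, hyz, hz⟩ := exists_other_neighbor hw hxw.symm
      refine edgeProperAt_of_other hz ?_
      rw [hoff s(y, z) (by simp [hyx, hzx]) (by simp [hyx, hyw']), hc z hyz,
        Sym2.eq_swap (a := y), hfw, ← hwc]
      exact he x hxw.ne _ _ hxw' hxw hne.symm
    · intro a b ha hb hab
      rw [hfar _ _ hyx hyw hyw', hfar _ _ hyx hyw hyw']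
      exact he y hyw a b ha hb hab

theorem eq_color_of_not_hasTotalColoring {G : SimpleGraph V} {κ : ℕ} (hκ : 5 ≤ κ)
    (hG : ¬ HasTotalColoring G κ)
    (hind : ∀ u v, G.Adj u v → deg G u = 2 → deg G v ≠ 2) {fv : V → Fin κ}
    {fe : Sym2 V → Fin κ} {w x : V} (hw : deg G w = 2) (hwx : G.Adj w x)
    (h : VertexProperOffTwo G fv fe) (he : ∀ y, y ≠ w → EdgeProperAt G fe y) :
    ∀ y, G.Adj w y → fe s(w, y) = fe s(w, x) := by
  intro y hy
  by_contra hne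
  obtain ⟨z, hzx, hwz, hz⟩ := exists_other_neighbor hw hwx
  obtain rfl : y = z := (hz y hy).resolve_left (by rintro rfl; exact hne rfl)
  refine hG (hasTotalColoring_of_off_two hκ hind h fun u => ?_)
  by_cases hu : u = w
  · subst hu
    exact edgeProperAt_of_other hz (Ne.symm hne)
  · exact he u hu

theorem hasTotalColoring_deleteEdge [Fintype V] {κ : ℕ} {G : SimpleGraph V}
    (hG : DeletionMinimal κ G) {u v : V} (huv : G.Adj u v) :
    ∃ (fv : V → Fin κ) (fe : Sym2 V → Fin κ),
      (∀ a b, G.Adj a b → s(a, b) ≠ s(u, v) → fv a ≠ fv b ∧ fv a ≠ fe s(a, b)) ∧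
      ∀ a b c, G.Adj a b → G.Adj a c → b ≠ c → s(a, b) ≠ s(u, v) → s(a, c) ≠ s(u, v) →
        fe s(a, b) ≠ fe s(a, c) := by
  have hlt : G.deleteEdges {s(u, v)} < G := by
    refine lt_of_le_of_ne (deleteEdges_le _) fun h => ?_
    have : (G.deleteEdges {s(u, v)}).Adj u v := by rwa [h]
    simp at this
  obtain ⟨fv, fe, h⟩ := (hasTotalColoring_iff_totalChromaticNumber_le _ _).mpr (hG.2.2 _ hlt)
  have hadj : ∀ {a b}, G.Adj a b → s(a, b) ≠ s(u, v) → (G.deleteEdges {s(u, v)}).Adj a b :=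
    fun h₁ h₂ => by rw [deleteEdges_adj]; exact ⟨h₁, h₂⟩
  refine ⟨fv, fe, fun a b hab hne => ⟨h.1 a b (hadj hab hne), ?_⟩, ?_⟩
  · exact h.2.2 a s(a, b) (hadj hab hne) (by simp)
  · intro a b c hab hac hbc h₁ h₂
    exact IsTotalColoring.edgeProperAt h a b c (hadj hab h₁) (hadj hac h₂) hbc

theorem deg_ne_two_of_adj [Fintype V] {κ : ℕ} (hκ : 5 ≤ κ) {G : SimpleGraph V}
    (hG : DeletionMinimal κ G) {u v : V} (huv : G.Adj u v) (hu : deg G u = 2) :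
    deg G v ≠ 2 := by
  classical
  intro hv
  obtain ⟨fv, fe, h₁, h₂⟩ := hasTotalColoring_deleteEdge hG huv
  obtain ⟨x, hxv, hux, hx⟩ := exists_other_neighbor hu huv
  obtain ⟨y, hyu, hvy, hy⟩ := exists_other_neighbor hv huv.symm
  obtain ⟨c, hc⟩ := exists_fresh {fe s(u, x), fe s(v, y)}
    (Finset.card_le_two.trans_lt (by omega))
  obtain ⟨p, hp⟩ := exists_fresh {fv x, c, fe s(u, x)}
    (Finset.card_le_three.trans_lt (by omega))
  obtain ⟨q, hq⟩ := exists_fresh {fv y, c, fe s(v, y), p}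
    (Finset.card_le_four.trans_lt hκ)
  simp only [Finset.mem_insert, Finset.mem_singleton, not_or] at hc hp hq
  have hne := huv.ne
  have hoff : ∀ a b, a ≠ u → a ≠ v → s(a, b) ≠ s(u, v) := by
    intro a b h h'; simp [h, h']
  have hux' : s(u, x) ≠ s(u, v) := by rwa [Ne, Sym2.congr_right]
  have hvy' : s(v, y) ≠ s(u, v) := by rwa [Sym2.eq_swap (a := u), Ne, Sym2.congr_right]
  have hvu : s(v, u) = s(u, v) := Sym2.eq_swap
  let gv : V → Fin κ := Function.update (Function.update fv u p) v q
  let ge : Sym2 V → Fin κ := Function.update fe s(u, v) c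
  have gvu : gv u = p := by simp [gv, hne]
  have gvv : gv v = q := by simp [gv]
  have gvo : ∀ a, a ≠ u → a ≠ v → gv a = fv a := by intro a h h'; simp [gv, h, h']
  have geo : ∀ e, e ≠ s(u, v) → ge e = fe e := by intro e h; simp [ge, h]
  have gec : ge s(u, v) = c := by simp [ge]
  have hxu := hux.ne'
  have hyv := hvy.ne'
  have hsymm : ∀ a b, G.Adj a b → (a = u ∨ a = v) → gv a ≠ gv b := by
    rintro a b hab (rfl | rfl)
    · rcases hx b hab with rfl | rfl
      · rw [gvu, gvv]; exact Ne.symm hq.2.2.2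
      · rw [gvu, gvo _ hxu hxv]; exact hp.1
    · rcases hy b hab with rfl | rfl
      · rw [gvu, gvv]; exact hq.2.2.2
      · rw [gvv, gvo _ hyu hyv]; exact hq.1
  refine (Nat.not_le.mpr hG.2.1) ((hasTotalColoring_iff_totalChromaticNumber_le G κ).mp
    ⟨gv, ge, isTotalColoring_of_edgeProperAt ?_ ?_ ?_⟩)
  · intro a b hab
    by_cases ha : a = u ∨ a = v
    · exact hsymm a b hab ha
    by_cases hb : b = u ∨ b = v
    · exact (hsymm b a hab.symm hb).symm
    push Not at ha hb
    rw [gvo a ha.1 ha.2, gvo b hb.1 hb.2]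
    exact (h₁ a b hab (hoff a b ha.1 ha.2)).1
  · intro a
    by_cases hau : a = u
    · subst hau
      refine edgeProperAt_of_other hx ?_
      rw [gec, geo _ hux']; exact hc.1
    by_cases hav : a = v
    · subst hav
      refine edgeProperAt_of_other hy ?_
      rw [hvu, gec, geo _ hvy']; exact hc.2
    intro b d hb hd hbd
    rw [geo _ (hoff a b hau hav), geo _ (hoff a d hau hav)]
    exact h₂ a b d hb hd hbd (hoff a b hau hav) (hoff a d hau hav)
  · intro a b hab
    by_cases hau : a = u
    · subst hau
      rcases hx b hab with rfl | rfl
      · rw [gvu, gec]; exact hp.2.1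
      · rw [gvu, geo _ hux']; exact hp.2.2
    by_cases hav : a = v
    · subst hav
      rcases hy b hab with rfl | rfl
      · rw [gvv, hvu, gec]; exact hq.2.1
      · rw [gvv, geo _ hvy']; exact hq.2.2.1
    rw [gvo a hau hav, geo _ (hoff a b hau hav)]
    exact (h₁ a b hab (hoff a b hau hav)).2

/-- If `w` has degree `2`, then `G` has a coloring that ignores the colors of vertices of degree
`2` and whose only possible conflict is between the two edges at `w`. -/
theorem exists_coloring_off_vertex [Fintype V] {κ : ℕ} (hκ : 5 ≤ κ) {G : SimpleGraph V}
    (hG : DeletionMinimal κ G) {v w : V} (hvw : G.Adj v w) (hw : deg G w = 2) :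
    ∃ (fv : V → Fin κ) (fe : Sym2 V → Fin κ), VertexProperOffTwo G fv fe ∧
      ∀ y, y ≠ w → EdgeProperAt G fe y := by
  classical
  obtain ⟨fv, fe, h₁, h₂⟩ := hasTotalColoring_deleteEdge hG hvw
  have hwv : s(w, v) = s(v, w) := Sym2.eq_swap
  obtain ⟨c, hc⟩ : ∃ c, c ≠ fv v ∧ ∀ y, G.Adj v y → y ≠ w → c ≠ fe s(v, y) := by
    let N : Finset V := (G.neighborSet v).toFinset
    have hN : N.card ≤ κ - 1 := by
      rw [← Set.ncard_eq_toFinset_card']; exact hG.1 v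
    have hwN : w ∈ N := by simpa [N] using hvw
    have hcard : (insert (fv v) ((N.erase w).image fun y => fe s(v, y))).card < κ := by
      refine (Finset.card_insert_le _ _).trans_lt ?_
      have := Finset.card_image_le (s := N.erase w) (f := fun y => fe s(v, y))
      rw [Finset.card_erase_of_mem hwN] at this
      omega
    obtain ⟨c, hc⟩ := exists_fresh _ hcard
    rw [Finset.mem_insert, not_or] at hc
    refine ⟨c, hc.1, fun y hy hyw h => hc.2 (Finset.mem_image.mpr ⟨y, ?_, h.symm⟩)⟩
    simpa [N, hyw] using hy
  let ge : Sym2 V → Fin κ := Function.update fe s(v, w) c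
  have geo : ∀ e, e ≠ s(v, w) → ge e = fe e := by intro e h; simp [ge, h]
  have gec : ge s(v, w) = c := by simp [ge]
  have hoff : ∀ a b, a ≠ v → a ≠ w → s(a, b) ≠ s(v, w) := by
    intro a b h h'; simp [h, h']
  have hv : ∀ b, b ≠ w → s(v, b) ≠ s(v, w) := by intro b h; rwa [Ne, Sym2.congr_right]
  refine ⟨fv, ge, ⟨?_, ?_⟩, ?_⟩
  · intro a b hab ha hb
    refine (h₁ a b hab ?_).1
    rw [Ne, Sym2.eq_iff]
    rintro (⟨-, rfl⟩ | ⟨rfl, -⟩)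
    exacts [hb hw, ha hw]
  · intro a b hab ha
    have haw : a ≠ w := by rintro rfl; exact ha hw
    by_cases hav : a = v
    · subst hav
      by_cases hbw : b = w
      · subst hbw; rw [gec]; exact hc.1.symm
      · rw [geo _ (hv b hbw)]; exact (h₁ a b hab (hv b hbw)).2
    · rw [geo _ (hoff a b hav haw)]; exact (h₁ a b hab (hoff a b hav haw)).2
  · intro a haw b d hb hd hbd
    by_cases hav : a = v
    · subst hav
      by_cases hbw : b = w
      · subst hbw
        rw [gec, geo _ (hv d hbd.symm)]; exact hc.2 d hd hbd.symm
      · by_cases hdw : d = w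
        · subst hdw
          rw [gec, geo _ (hv b hbd)]; exact (hc.2 b hb hbd).symm
        · rw [geo _ (hv b hbw), geo _ (hv d hdw)]
          exact h₂ a b d hb hd hbd (hv b hbw) (hv d hdw)
    · rw [geo _ (hoff a b hav haw), geo _ (hoff a d hav haw)]
      exact h₂ a b d hb hd hbd (hoff a b hav haw) (hoff a d hav haw)

/-- `w` has degree `2`, and some coloring has its only conflict at `w`, between two edges of
color `c`, while the edge `e₀` also has color `c`. -/
def ConflictAt (G : SimpleGraph V) {α : Type*} (fv : V → α) (c : α) (e₀ : Sym2 V) (w : V) :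
    Prop :=
  deg G w = 2 ∧ ∃ fe : Sym2 V → α, VertexProperOffTwo G fv fe ∧
    (∀ y, y ≠ w → EdgeProperAt G fe y) ∧ (∀ y, G.Adj w y → fe s(w, y) = c) ∧ fe e₀ = c

theorem ConflictAt.move {G : SimpleGraph V} {κ : ℕ} (hκ : 5 ≤ κ)
    (hG : ¬ HasTotalColoring G κ)
    (hind : ∀ u v, G.Adj u v → deg G u = 2 → deg G v ≠ 2) {fv : V → Fin κ} {c : Fin κ}
    {e₀ : Sym2 V} {w x w' : V} (h : ConflictAt G fv c e₀ w) (hxw : G.Adj x w)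
    (hxw' : G.Adj x w') (hw' : deg G w' = 2) (he : s(x, w) ≠ e₀) (he' : s(x, w') ≠ e₀) :
    ConflictAt G fv c e₀ w' := by
  obtain rfl | hne := eq_or_ne w w'
  · exact h
  obtain ⟨hw, fe, h₁, h₂, h₃, h₄⟩ := h
  obtain ⟨fe', h₁', h₂', h₃', h₄'⟩ := exists_swap hw hw' hxw hxw' hne h₁ h₂ h₃
  refine ⟨hw', fe', h₁', h₂', fun y hy => ?_, (h₄' _ he.symm he'.symm).trans h₄⟩
  rw [eq_color_of_not_hasTotalColoring hκ hG hind hw' hxw'.symm h₁' h₂' y hy, Sym2.eq_swap, h₃']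

/-- An edge `vw` with `w` of degree `2` lies on no cycle of edges incident with vertices of
degree `2`. -/
theorem not_reachable [Fintype V] {κ : ℕ} (hκ : 5 ≤ κ) {G : SimpleGraph V}
    (hG : DeletionMinimal κ G) {F : SimpleGraph V} {v w : V}
    (hF : ∀ a b, F.Adj a b → G.Adj a b ∧ (deg G a = 2 ∨ deg G b = 2) ∧ s(a, b) ≠ s(v, w))
    (hvw : G.Adj v w) (hw : deg G w = 2) : ¬ F.Reachable w v := by
  have hind : ∀ u v, G.Adj u v → deg G u = 2 → deg G v ≠ 2 :=
    fun u v huv => deg_ne_two_of_adj hκ hG huv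
  have hnot : ¬ HasTotalColoring G κ := fun h =>
    Nat.not_le.mpr hG.2.1 ((hasTotalColoring_iff_totalChromaticNumber_le G κ).mp h)
  obtain ⟨fv, fe, h₁, h₂⟩ := exists_coloring_off_vertex hκ hG hvw hw
  let c := fe s(w, v)
  have hstart : ConflictAt G fv c s(v, w) w :=
    ⟨hw, fe, h₁, h₂, eq_color_of_not_hasTotalColoring hκ hnot hind hw hvw.symm h₁ h₂,
      by rw [Sym2.eq_swap]⟩
  intro hr
  have hinv : ∀ x, F.Reachable w x →
      ConflictAt G fv c s(v, w) x ∨ ∃ u, F.Adj u x ∧ ConflictAt G fv c s(v, w) u := by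
    intro x hx
    rw [reachable_iff_reflTransGen] at hx
    induction hx with
    | refl => exact .inl hstart
    | @tail y z _ hyz ih =>
      rcases ih with h | ⟨u, huy, hu⟩
      · exact .inr ⟨y, hyz, h⟩
      · obtain ⟨hGyz, hdeg, hne⟩ := hF y z hyz
        obtain ⟨hGuy, -, hne'⟩ := hF u y huy
        have hz : deg G z = 2 := hdeg.resolve_left (hind u y hGuy hu.1)
        exact .inl (hu.move hκ hnot hind hGuy.symm hGyz hz (by rwa [Sym2.eq_swap]) hne)
  have hv : deg G v ≠ 2 := hind w v hvw.symm hw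
  rcases hinv v hr with h | ⟨u, huv, hu, fe', -, hprop, hc, hc₀⟩
  · exact hv h.1
  · obtain ⟨hGuv, -, hne⟩ := hF u v huv
    refine hprop v hGuv.ne' u w hGuv.symm hvw ?_ ?_
    · rintro rfl; exact hne Sym2.eq_swap
    · rw [hc₀, Sym2.eq_swap, hc v hGuv]

end TotalColoring

/-- for κ ≥ 5, in a κ-deletion-minimal graph the subgraph induced by
the edges incident with vertices of degree 2 is a forest (acyclic). -/
theorem stmt_5 {V : Type*} [Fintype V] (κ : ℕ) (hκ : 5 ≤ κ) (G : SimpleGraph V)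
    (hG : DeletionMinimal κ G) :
    (SimpleGraph.fromRel
      (fun u w : V => G.Adj u w ∧ (deg G u = 2 ∨ deg G w = 2))).IsAcyclic := by
  classical
  rw [isAcyclic_iff_forall_adj_isBridge]
  intro a b hab
  rw [isBridge_iff]
  rw [fromRel_adj] at hab
  have hab' : G.Adj a b ∧ (deg G a = 2 ∨ deg G b = 2) := by
    rcases hab.2 with h | h
    exacts [h, ⟨h.1.symm, h.2.symm⟩]
  have hF : ∀ x y, ((fromRel fun u w : V => G.Adj u w ∧ (deg G u = 2 ∨ deg G w = 2)) \
      fromEdgeSet {s(a, b)}).Adj x y →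
      G.Adj x y ∧ (deg G x = 2 ∨ deg G y = 2) ∧ s(x, y) ≠ s(a, b) := by
    intro x y h
    simp only [sdiff_adj, fromRel_adj, fromEdgeSet_adj, Set.mem_singleton_iff] at h
    obtain ⟨⟨hxy, h⟩, hne⟩ := h
    refine ⟨?_, ?_, fun h => hne ⟨h, hxy⟩⟩
    · rcases h with h | h
      exacts [h.1, h.1.symm]
    · rcases h with h | h
      exacts [h.2, h.2.symm]
  intro hr
  rcases hab'.2 with ha | hb
  · refine TotalColoring.not_reachable hκ hG (fun x y h => ?_) hab'.1.symm ha hr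
    rw [Sym2.eq_swap (a := b)]
    exact hF x y h
  · exact TotalColoring.not_reachable hκ hG hF hab'.1 hb hr.symm
end

section
/- Let G be a κ-deletion-minimal graph with respect to total coloring, and let w be a vertex with neighbors w₁, w₂, w₃ such that w₁w₂ is an edge of G. If deg(w) + deg(w₁) = κ + 1 and deg(w₁) ≤ ⌊(κ−1)/2⌋, then deg(w) + deg(w₃) ≥ κ + 2. -/
open SimpleGraph

variable {V : Type*}

theorem SimpleGraph.adj_of_sup_edge_adj {V : Type*} {H : SimpleGraph V} {a b u v : V}
    (h : (H ⊔ edge a b).Adj u v) (hne : s(u, v) ≠ s(a, b)) : H.Adj u v := by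
  rw [sup_adj, edge_adj, ← Sym2.eq_iff, eq_comm] at h
  exact h.resolve_right fun h' => hne h'.1.symm

theorem SimpleGraph.le_sup_edge_of_deleteEdges_le {V : Type*} {G H : SimpleGraph V} {a b : V}
    (h : G.deleteEdges {s(a, b)} ≤ H) : G ≤ H ⊔ edge a b := by
  intro u v huv
  by_cases he : s(u, v) = s(a, b)
  · rw [sup_adj, edge_adj, ← Sym2.eq_iff]
    exact Or.inr ⟨he, huv.ne⟩
  · exact Or.inl (h (by simpa [deleteEdges_adj, huv] using he))

/-- A total coloring in which the vertices of `U` are left uncolored. -/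
def IsPartialTotalColoring {V α : Type*} (G : SimpleGraph V) (U : Set V) (fv : V → α)
    (fe : Sym2 V → α) : Prop :=
  (∀ u v, G.Adj u v → u ∉ U → v ∉ U → fv u ≠ fv v) ∧
  (∀ u v v', G.Adj u v → G.Adj u v' → v ≠ v' → fe s(u, v) ≠ fe s(u, v')) ∧
  (∀ u v, G.Adj u v → u ∉ U → fv u ≠ fe s(u, v))

namespace IsTotalColoring

variable {V α : Type*} {G : SimpleGraph V} {fv : V → α} {fe : Sym2 V → α}

theorem mono {H : SimpleGraph V} (h : IsTotalColoring G fv fe) (hle : H ≤ G) :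
    IsTotalColoring H fv fe :=
  ⟨fun u v huv => h.1 u v (hle huv),
    fun e₁ e₂ h₁ h₂ => h.2.1 e₁ e₂ (edgeSet_mono hle h₁) (edgeSet_mono hle h₂),
    fun v e he => h.2.2 v e (edgeSet_mono hle he)⟩

theorem comp_injective {β : Type*} {g : α → β} (hg : g.Injective)
    (h : IsTotalColoring G fv fe) : IsTotalColoring G (g ∘ fv) (g ∘ fe) :=
  ⟨fun u v huv => hg.ne (h.1 u v huv),
    fun e₁ e₂ h₁ h₂ hne hw => hg.ne (h.2.1 e₁ e₂ h₁ h₂ hne hw),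
    fun v e he hv => hg.ne (h.2.2 v e he hv)⟩

theorem isPartialTotalColoring (h : IsTotalColoring G fv fe) (U : Set V) :
    IsPartialTotalColoring G U fv fe := by
  refine ⟨fun u v huv _ _ => h.1 u v huv, fun u v v' huv huv' hne => ?_,
    fun u v huv _ => h.2.2 u _ huv (Sym2.mem_mk_left u v)⟩
  refine h.2.1 _ _ huv huv' (fun he => hne (Sym2.congr_right.1 he))
    ⟨u, Sym2.mem_mk_left u v, Sym2.mem_mk_left u v'⟩

end IsTotalColoring

namespace IsPartialTotalColoring

variable {V α : Type*} {G H : SimpleGraph V} {U : Set V} {fv : V → α} {fe : Sym2 V → α}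

theorem mono (h : IsPartialTotalColoring G U fv fe) (hle : H ≤ G) :
    IsPartialTotalColoring H U fv fe :=
  ⟨fun u v huv => h.1 u v (hle huv), fun u v v' huv huv' => h.2.1 u v v' (hle huv) (hle huv'),
    fun u v huv => h.2.2 u v (hle huv)⟩

theorem isTotalColoring (h : IsPartialTotalColoring G ∅ fv fe) : IsTotalColoring G fv fe := by
  refine ⟨fun u v huv => h.1 u v huv (Set.notMem_empty u) (Set.notMem_empty v), ?_, ?_⟩
  · rintro e₁ e₂ h₁ h₂ hne ⟨w, hw₁, hw₂⟩
    obtain ⟨a, rfl⟩ := hw₁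
    obtain ⟨b, rfl⟩ := hw₂
    exact h.2.1 w a b h₁ h₂ (by rintro rfl; exact hne rfl)
  · rintro v e he ⟨a, rfl⟩
    exact h.2.2 v a he (Set.notMem_empty v)

/-- A new edge may receive any color that is missing at both of its ends. -/
theorem sup_edge [DecidableEq V] (h : IsPartialTotalColoring H U fv fe) {a b : V} {x : α}
    (hab : ¬ H.Adj a b)
    (hv : a ∉ U → b ∉ U → fv a ≠ fv b) (hva : a ∉ U → fv a ≠ x) (hvb : b ∉ U → fv b ≠ x)
    (ha : ∀ v, H.Adj a v → fe s(a, v) ≠ x) (hb : ∀ v, H.Adj b v → fe s(b, v) ≠ x) :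
    IsPartialTotalColoring (H ⊔ edge a b) U fv (Function.update fe s(a, b) x) := by
  have hne : ∀ u v, H.Adj u v → s(u, v) ≠ s(a, b) := by
    intro u v huv he
    rw [Sym2.eq_iff] at he
    rcases he with ⟨rfl, rfl⟩ | ⟨rfl, rfl⟩
    · exact hab huv
    · exact hab huv.symm
  have hadj : ∀ {u v}, (H ⊔ edge a b).Adj u v → H.Adj u v ∨ (u = a ∧ v = b) ∨ (u = b ∧ v = a) := by
    intro u v huv
    rw [sup_adj, edge_adj] at huv
    tauto
  refine ⟨?_, ?_, ?_⟩
  · intro u v huv hu hv'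
    rcases hadj huv with h' | ⟨rfl, rfl⟩ | ⟨rfl, rfl⟩
    · exact h.1 u v h' hu hv'
    · exact hv hu hv'
    · exact (hv hv' hu).symm
  · intro u v v' huv huv' hvv
    rcases hadj huv with h' | ⟨rfl, rfl⟩ | ⟨rfl, rfl⟩ <;>
    rcases hadj huv' with h'' | ⟨h₁, h₂⟩ | ⟨h₁, h₂⟩
    · rw [Function.update_of_ne (hne _ _ h'), Function.update_of_ne (hne _ _ h'')]
      exact h.2.1 u v v' h' h'' hvv
    · subst h₁ h₂
      rw [Function.update_of_ne (hne _ _ h'), Function.update_self]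
      exact ha v h'
    · subst h₁ h₂
      rw [Function.update_of_ne (hne _ _ h'), Sym2.eq_swap (a := u) (b := v'),
        Function.update_self]
      exact hb v h'
    · rw [Function.update_of_ne (hne _ _ h''), Function.update_self]
      exact (ha v' h'').symm
    · exact absurd h₂.symm hvv
    · exact absurd (h₂.trans h₁).symm hvv
    · rw [Function.update_of_ne (hne _ _ h''), Sym2.eq_swap, Function.update_self]
      exact (hb v' h'').symm
    · subst h₁
      exact absurd h₂.symm hvv
    · exact absurd h₂.symm hvv
  · intro u v huv hu
    rcases hadj huv with h' | ⟨rfl, rfl⟩ | ⟨rfl, rfl⟩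
    · rw [Function.update_of_ne (hne _ _ h')]
      exact h.2.2 u v h' hu
    · rw [Function.update_self]
      exact hva hu
    · rw [Sym2.eq_swap, Function.update_self]
      exact hvb hu

/-- An uncolored vertex of small degree can be colored greedily. -/
theorem exists_of_insert [Finite V] {n : ℕ} {fv : V → Fin n} {fe : Sym2 V → Fin n} {u : V}
    (h : IsPartialTotalColoring G (insert u U) fv fe) (hu : 2 * deg G u < n) :
    ∃ fv' : V → Fin n, IsPartialTotalColoring G U fv' fe := by
  classical
  obtain ⟨x, hx⟩ : ∃ x, x ∉ fv '' G.neighborSet u ∪ (fun v => fe s(u, v)) '' G.neighborSet u := by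
    by_contra! hall
    have huniv := Set.eq_univ_of_forall hall
    have hcard := Set.ncard_union_le (fv '' G.neighborSet u)
      ((fun v => fe s(u, v)) '' G.neighborSet u)
    rw [huniv, Set.ncard_univ, Nat.card_fin] at hcard
    have h₁ := Set.ncard_image_le (f := fv) (G.neighborSet u).toFinite
    have h₂ := Set.ncard_image_le (f := fun v => fe s(u, v)) (G.neighborSet u).toFinite
    unfold deg at hu
    omega
  have hx₁ : ∀ v, G.Adj u v → fv v ≠ x := fun v hv he => hx (Or.inl ⟨v, hv, he⟩)
  have hx₂ : ∀ v, G.Adj u v → fe s(u, v) ≠ x := fun v hv he => hx (Or.inr ⟨v, hv, he⟩)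
  refine ⟨Function.update fv u x, ?_, h.2.1, ?_⟩
  · intro a b hab ha hb
    by_cases hau : a = u
    · subst hau
      rw [Function.update_self, Function.update_of_ne hab.ne']
      exact (hx₁ b hab).symm
    by_cases hbu : b = u
    · subst hbu
      rw [Function.update_self, Function.update_of_ne hau]
      exact hx₁ a hab.symm
    rw [Function.update_of_ne hau, Function.update_of_ne hbu]
    exact h.1 a b hab (by simp [hau, ha]) (by simp [hbu, hb])
  · intro a b hab ha
    by_cases hau : a = u
    · subst hau
      rw [Function.update_self]
      exact (hx₂ b hab).symm
    rw [Function.update_of_ne hau]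
    exact h.2.2 a b hab (by simp [hau, ha])

end IsPartialTotalColoring

theorem HasTotalColoring.mono_right {V : Type*} {G : SimpleGraph V} {m n : ℕ} (hmn : m ≤ n)
    (h : HasTotalColoring G m) : HasTotalColoring G n := by
  obtain ⟨fv, fe, hc⟩ := h
  exact ⟨_, _, hc.comp_injective (Fin.castLE_injective hmn)⟩

namespace DeletionMinimal

variable {V : Type*} {G H : SimpleGraph V} {κ : ℕ}

theorem not_hasTotalColoring (hG : DeletionMinimal κ G) : ¬ HasTotalColoring G κ :=
  fun h => hG.2.1.not_ge (Nat.sInf_le h)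

theorem hasTotalColoring_of_lt (hG : DeletionMinimal κ G) (hlt : H < G) :
    HasTotalColoring H κ := by
  have hne : {n | HasTotalColoring G n}.Nonempty :=
    Nat.nonempty_of_pos_sInf (Nat.zero_lt_of_lt hG.2.1)
  have hneH : {n | HasTotalColoring H n}.Nonempty := by
    obtain ⟨n, fv, fe, hc⟩ := hne
    exact ⟨n, fv, fe, hc.mono hlt.le⟩
  exact (Nat.sInf_mem hneH).mono_right (hG.2.2 H hlt)

end DeletionMinimal

theorem Fin.disjoint_of_union_eq_univ {n : ℕ} {A B : Set (Fin n)} (h : A ∪ B = Set.univ)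
    (hcard : A.ncard + B.ncard ≤ n) : Disjoint A B := by
  have := Set.ncard_union_add_ncard_inter A B
  rw [h, Set.ncard_univ, Nat.card_fin] at this
  rw [Set.disjoint_iff_inter_eq_empty, ← Set.ncard_eq_zero]
  omega

/-- The colors of the edges joining `u` to its neighbors other than `v`. -/
def edgePalette {V α : Type*} (G : SimpleGraph V) (fe : Sym2 V → α) (u v : V) : Set α :=
  (fun x => fe s(u, x)) '' (G.neighborSet u \ {v})

theorem ncard_edgePalette_lt {V α : Type*} [Finite V] {G : SimpleGraph V} (fe : Sym2 V → α)
    {u v : V} (huv : G.Adj u v) : (edgePalette G fe u v).ncard < deg G u :=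
  (Set.ncard_image_le (Set.toFinite _)).trans_lt
    (Set.ncard_sdiff_singleton_lt_of_mem huv (Set.toFinite _))

/-- The color of `u` together with the colors of its edges to neighbors other than `v`. -/
def palette {V α : Type*} (G : SimpleGraph V) (fv : V → α) (fe : Sym2 V → α) (u v : V) : Set α :=
  insert (fv u) (edgePalette G fe u v)

theorem ncard_palette_le {V α : Type*} [Finite V] {G : SimpleGraph V} (fv : V → α)
    (fe : Sym2 V → α) {u v : V} (huv : G.Adj u v) : (palette G fv fe u v).ncard ≤ deg G u :=
  (Set.ncard_insert_le _ _).trans (ncard_edgePalette_lt fe huv)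

/-- in a κ-deletion-minimal graph, if `w₁, w₂, w₃` are distinct
neighbors of `w` with `w₁w₂ ∈ E(G)`, `deg w + deg w₁ = κ + 1` and
`deg w₁ ≤ ⌊(κ-1)/2⌋`, then `deg w + deg w₃ ≥ κ + 2`. -/
theorem stmt_10 {V : Type*} [Fintype V] (κ : ℕ) (G : SimpleGraph V)
    (hG : DeletionMinimal κ G) (w w₁ w₂ w₃ : V)
    (h1 : G.Adj w w₁) (h2 : G.Adj w w₂) (h3 : G.Adj w w₃)
    (hd : w₁ ≠ w₂) (hd' : w₁ ≠ w₃) (hd'' : w₂ ≠ w₃)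
    (h12 : G.Adj w₁ w₂)
    (hsum : deg G w + deg G w₁ = κ + 1) (hw1 : deg G w₁ ≤ (κ - 1) / 2) :
    κ + 2 ≤ deg G w + deg G w₃ := by
  classical
  by_contra! hlt
  have hnc : ∀ fv (fe : Sym2 V → Fin κ), ¬ IsPartialTotalColoring G {w₁, w₃} fv fe := by
    intro fv fe h
    obtain ⟨fv₁, h₁⟩ := h.exists_of_insert (by have := ncard_edgePalette_lt fe h1.symm; omega)
    rw [← insert_empty_eq w₃] at h₁
    obtain ⟨fv₂, h₂⟩ := h₁.exists_of_insert (by have := ncard_edgePalette_lt fe h1.symm; omega)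
    exact hG.not_hasTotalColoring ⟨fv₂, fe, h₂.isTotalColoring⟩
  have hwU : w ∉ ({w₁, w₃} : Set V) := by simp [h1.ne, h3.ne]
  have hw₂U : w₂ ∉ ({w₁, w₃} : Set V) := by simp [hd.symm, hd'']
  have hw₁U : w₁ ∈ ({w₁, w₃} : Set V) := by simp
  have hw₃U : w₃ ∈ ({w₁, w₃} : Set V) := by simp
  set H := G.deleteEdges {s(w, w₁)} with hH
  have hHadj : ∀ u v, H.Adj u v ↔ G.Adj u v ∧ s(u, v) ≠ s(w, w₁) := by
    intro u v; simp [hH, deleteEdges_adj]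
  have hmemA : ∀ {fv} {fe : Sym2 V → Fin κ} {v}, G.Adj w v → v ≠ w₁ →
      fe s(w, v) ∈ palette G fv fe w w₁ := fun hv hne => Or.inr ⟨_, ⟨hv, hne⟩, rfl⟩
  have hmemB : ∀ {fe : Sym2 V → Fin κ} {u v}, G.Adj u v → v ≠ w →
      fe s(u, v) ∈ edgePalette G fe u w := fun hv hne => ⟨_, ⟨hv, hne⟩, rfl⟩
  have hdisj₁ : ∀ fv (fe : Sym2 V → Fin κ), IsPartialTotalColoring H {w₁, w₃} fv fe →
      Disjoint (palette G fv fe w w₁) (edgePalette G fe w₁ w) := by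
    intro fv fe h
    refine Fin.disjoint_of_union_eq_univ (Set.eq_univ_of_forall fun x => ?_) ?_
    · by_contra hx
      rw [Set.mem_union, not_or] at hx
      refine hnc fv _ ((h.sup_edge (a := w) (b := w₁) (x := x) ?_ ?_ ?_ ?_ ?_ ?_).mono ?_)
      · simp [hHadj]
      · exact fun _ h' => absurd hw₁U h'
      · rintro - rfl
        exact hx.1 (Or.inl rfl)
      · exact fun h' => absurd hw₁U h'
      · rintro v hv rfl
        rw [hHadj] at hv
        exact hx.1 (hmemA hv.1 (by rintro rfl; exact hv.2 rfl))
      · rintro v hv rfl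
        rw [hHadj] at hv
        exact hx.2 (hmemB hv.1 (by rintro rfl; exact hv.2 Sym2.eq_swap))
      · exact le_sup_edge_of_deleteEdges_le le_rfl
    · have := ncard_palette_le fv fe h1
      have := ncard_edgePalette_lt fe h1.symm
      omega
  have huniv₃ : ∀ fv (fe : Sym2 V → Fin κ), IsPartialTotalColoring H {w₁, w₃} fv fe →
      palette G fv fe w w₁ ∪ edgePalette G fe w₃ w = Set.univ := by
    intro fv fe h
    refine Set.eq_univ_of_forall fun x => ?_
    by_contra hx
    rw [Set.mem_union, not_or] at hx
    have hdis := Set.disjoint_left.1 (hdisj₁ fv fe h)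
    set K := G.deleteEdges {s(w, w₁), s(w, w₃)} with hK
    have hKadj : ∀ u v, K.Adj u v ↔ G.Adj u v ∧ s(u, v) ≠ s(w, w₁) ∧ s(u, v) ≠ s(w, w₃) := by
      intro u v; simp [hK, deleteEdges_adj]
    have hKH : K ≤ H := fun u v huv =>
      (hHadj u v).2 ⟨((hKadj u v).1 huv).1, ((hKadj u v).1 huv).2.1⟩
    have hH3 : H.Adj w w₃ := (hHadj _ _).2 ⟨h3, fun he => hd' (Sym2.congr_right.1 he).symm⟩
    have hs₁ := (h.mono hKH).sup_edge (a := w) (b := w₁) (x := fe s(w, w₃)) (by simp [hKadj])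
      (fun _ h' => absurd hw₁U h') (fun _ => h.2.2 w w₃ hH3 hwU) (fun h' => absurd hw₁U h')
      (fun v hv => h.2.1 w v w₃ (hKH hv) hH3 (by rintro rfl; exact ((hKadj _ _).1 hv).2.2 rfl))
      (fun v hv he => hdis (hmemA h3 hd'.symm) (he ▸ hmemB ((hKadj _ _).1 hv).1
        (by rintro rfl; exact ((hKadj _ _).1 hv).2.1 Sym2.eq_swap)))
    refine hnc fv _ ((hs₁.sup_edge (a := w) (b := w₃) (x := x) ?_ ?_ ?_ ?_ ?_ ?_).mono ?_)
    · simp [hKadj, edge_adj, hd'.symm, h1.ne, h3.ne]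
    · exact fun _ h' => absurd hw₃U h'
    · rintro - rfl
      exact hx.1 (Or.inl rfl)
    · exact fun h' => absurd hw₃U h'
    · rintro v hv he
      by_cases hv₁ : v = w₁
      · subst hv₁
        rw [Function.update_self] at he
        exact hx.1 (he ▸ hmemA h3 hd'.symm)
      · rw [Function.update_of_ne (fun he => hv₁ (Sym2.congr_right.1 he))] at he
        have hGv : G.Adj w v :=
          ((hKadj _ _).1 (adj_of_sup_edge_adj hv fun he => hv₁ (Sym2.congr_right.1 he))).1
        exact hx.1 (he ▸ hmemA hGv hv₁)
    · rintro v hv he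
      have hne : s(w₃, v) ≠ s(w, w₁) := by
        simp [hd'.symm, h3.ne']
      rw [Function.update_of_ne hne] at he
      have hKv : K.Adj w₃ v := adj_of_sup_edge_adj hv hne
      rw [hKadj] at hKv
      exact hx.2 (he ▸ hmemB hKv.1 (by rintro rfl; exact hKv.2.2 Sym2.eq_swap))
    · refine le_sup_edge_of_deleteEdges_le (le_sup_edge_of_deleteEdges_le ?_)
      rw [deleteEdges_deleteEdges, Set.singleton_union, Set.pair_comm]
  obtain ⟨fv, fe, hc⟩ := hG.hasTotalColoring_of_lt (H := H) (by
    refine lt_of_le_of_ne (deleteEdges_le _) fun he => ?_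
    rw [← he, hHadj] at h1
    exact h1.2 rfl)
  have h := hc.isPartialTotalColoring {w₁, w₃}
  have hdis₁ := Set.disjoint_left.1 (hdisj₁ fv fe h)
  have hβ₁ : fe s(w, w₂) ∉ edgePalette G fe w₁ w := hdis₁ (hmemA h2 hd.symm)
  have hα : fe s(w₁, w₂) ∉ palette G fv fe w w₁ := fun h' => hdis₁ h' (hmemB h12 h2.ne')
  have hβ₃ : fe s(w, w₂) ∉ edgePalette G fe w₃ w := by
    refine Set.disjoint_left.1 (Fin.disjoint_of_union_eq_univ (huniv₃ fv fe h) ?_)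
      (hmemA h2 hd.symm)
    have := ncard_palette_le fv fe h1
    have := ncard_edgePalette_lt fe h3.symm
    omega
  have hH2 : H.Adj w w₂ := (hHadj _ _).2 ⟨h2, fun he => hd (Sym2.congr_right.1 he).symm⟩
  have hH12 : H.Adj w₁ w₂ := (hHadj _ _).2 ⟨h12, by simp [h2.ne', h1.ne']⟩
  set K := H.deleteEdges {s(w, w₂), s(w₁, w₂)} with hK
  have hKadj : ∀ u v, K.Adj u v ↔ H.Adj u v ∧ s(u, v) ≠ s(w, w₂) ∧ s(u, v) ≠ s(w₁, w₂) := by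
    intro u v; simp [hK, deleteEdges_adj]
  have hKH : K ≤ H := fun u v huv => ((hKadj u v).1 huv).1
  have hαβ : fe s(w, w₂) ≠ fe s(w₁, w₂) := fun he => hα (he ▸ hmemA h2 hd.symm)
  have hs₁ := (h.mono hKH).sup_edge (a := w) (b := w₂) (x := fe s(w₁, w₂)) (by simp [hKadj])
    (h.1 w w₂ hH2) (fun _ he => hα (Or.inl he.symm))
    (fun _ => by rw [Sym2.eq_swap]; exact h.2.2 w₂ w₁ hH12.symm hw₂U)
    (fun v hv he => hα (he ▸ hmemA ((hHadj _ _).1 (hKH hv)).1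
      (by rintro rfl; exact ((hHadj _ _).1 (hKH hv)).2 rfl)))
    (fun v hv => by
      rw [Sym2.eq_swap (a := w₁)]
      exact h.2.1 w₂ v w₁ (hKH hv) hH12.symm
        (by rintro rfl; exact ((hKadj _ _).1 hv).2.2 Sym2.eq_swap))
  have hs₂ := hs₁.sup_edge (a := w₁) (b := w₂) (x := fe s(w, w₂))
    (by simp [hKadj, edge_adj, h1.ne', hd])
    (fun h' => absurd hw₁U h') (fun h' => absurd hw₁U h')
    (fun _ => by rw [Sym2.eq_swap]; exact h.2.2 w₂ w hH2.symm hw₂U)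
    (fun v hv he => by
      have hne : s(w₁, v) ≠ s(w, w₂) := by simp [hd, h1.ne']
      rw [Function.update_of_ne hne] at he
      have hHv := hKH (adj_of_sup_edge_adj hv hne)
      rw [hHadj] at hHv
      exact hβ₁ (he ▸ hmemB hHv.1 (by rintro rfl; exact hHv.2 Sym2.eq_swap)))
    (fun v hv he => by
      by_cases hvw : v = w
      · subst hvw
        rw [Sym2.eq_swap (a := w₂), Function.update_self] at he
        exact hαβ he.symm
      · have hne : s(w₂, v) ≠ s(w, w₂) := by simp [hvw, h2.ne']
        rw [Function.update_of_ne hne] at he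
        have hHv := hKH (adj_of_sup_edge_adj hv hne)
        rw [Sym2.eq_swap (a := w)] at he
        exact h.2.1 w₂ v w hHv hH2.symm hvw he)
  have huniv := huniv₃ fv _ (hs₂.mono (H := H) (by
    refine le_sup_edge_of_deleteEdges_le (le_sup_edge_of_deleteEdges_le ?_)
    rw [deleteEdges_deleteEdges, Set.singleton_union, Set.pair_comm]))
  rcases Set.mem_union _ _ _ |>.1 (huniv ▸ Set.mem_univ (fe s(w, w₂))) with
    (he | ⟨v, ⟨hv, hv₁⟩, he⟩) | ⟨v, ⟨hv, hvw⟩, he⟩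
  · exact h.2.2 w w₂ hH2 hwU he.symm
  · have hne : s(w, v) ≠ s(w₁, w₂) := by simp [h1.ne, h2.ne]
    simp only [Function.update_of_ne hne] at he
    by_cases hv₂ : v = w₂
    · subst hv₂
      rw [Function.update_self] at he
      exact hαβ he.symm
    · rw [Function.update_of_ne (fun he => hv₂ (Sym2.congr_right.1 he))] at he
      exact h.2.1 w v w₂ ((hHadj _ _).2 ⟨hv, fun he => hv₁ (Sym2.congr_right.1 he)⟩) hH2 hv₂ he
  · have hne : s(w₃, v) ≠ s(w₁, w₂) := by simp [hd'.symm, hd''.symm]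
    have hne' : s(w₃, v) ≠ s(w, w₂) := by simp [h3.ne', hd''.symm]
    simp only [Function.update_of_ne hne, Function.update_of_ne hne'] at he
    exact hβ₃ (he ▸ hmemB hv hvw)
end

section
/- Let κ ≥ 7 and let G be a κ-deletion-minimal graph with respect to total coloring. If v is a vertex of G adjacent to a 2-vertex u such that u is not in a triangle, and the edge vv₂ is contained in two triangles vv₁v₂ and vv₂v₃, then deg_G(v₂) ≠ 3. -/
open SimpleGraph

variable {V : Type*}

/-- `fv` and the symmetric function `fe` form a total coloring of `G` in which the vertices of `S`
are regarded as uncolored. -/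
structure IsPartialTotalColoring_s14 (G : SimpleGraph V) {α : Type*} (S : Set V) (fv : V → α)
    (fe : V → V → α) : Prop where
  symm : ∀ p q, fe p q = fe q p
  vertex : ∀ p q, p ∉ S → q ∉ S → G.Adj p q → fv p ≠ fv q
  edge : ∀ p q r, G.Adj p q → G.Adj p r → q ≠ r → fe p q ≠ fe p r
  incident : ∀ p q, p ∉ S → G.Adj p q → fv p ≠ fe p q

theorem IsTotalColoring.isPartialTotalColoring_s14 {G : SimpleGraph V} {α : Type*} {fv : V → α}
    {fe : Sym2 V → α} (h : IsTotalColoring G fv fe) (S : Set V) :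
    IsPartialTotalColoring_s14 G S fv (fun p q => fe s(p, q)) where
  symm p q := by rw [Sym2.eq_swap]
  vertex p q _ _ hpq := h.1 p q hpq
  edge p q r hq hr hqr :=
    h.2.1 _ _ hq hr (fun hs => hqr (Sym2.congr_right.1 hs)) ⟨p, by simp, by simp⟩
  incident p q _ hpq := h.2.2 p _ hpq (by simp)

theorem IsPartialTotalColoring_s14.exists_isTotalColoring {G : SimpleGraph V} {α : Type*} {fv : V → α}
    {fe : V → V → α} (h : IsPartialTotalColoring_s14 G ∅ fv fe) :
    ∃ fe' : Sym2 V → α, IsTotalColoring G fv fe' := by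
  refine ⟨Sym2.lift ⟨fe, h.symm⟩, fun p q => h.vertex p q (by simp) (by simp), ?_, ?_⟩
  · rintro e₁ e₂ h₁ h₂ hne ⟨w, hw₁, hw₂⟩
    obtain ⟨q, rfl⟩ := hw₁
    obtain ⟨r, rfl⟩ := hw₂
    exact h.edge w q r h₁ h₂ (by rintro rfl; exact hne rfl)
  · rintro w e he ⟨q, rfl⟩
    exact h.incident w q (by simp) he

/-- A vertex with few neighbors can be colored last. -/
theorem IsPartialTotalColoring_s14.exists_color_vertex [Finite V] {G : SimpleGraph V} {κ : ℕ}
    {S : Set V} {x : V} {fv : V → Fin κ} {fe : V → V → Fin κ}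
    (h : IsPartialTotalColoring_s14 G (insert x S) fv fe) (hx : 2 * deg G x < κ) :
    ∃ fv', IsPartialTotalColoring_s14 G S fv' fe := by
  classical
  obtain ⟨c, hc⟩ : ∃ c, c ∉ fv '' G.neighborSet x ∪ fe x '' G.neighborSet x := by
    by_contra! hall
    have h₁ := Set.ncard_union_le (fv '' G.neighborSet x) (fe x '' G.neighborSet x)
    have h₂ := Set.ncard_image_le (f := fv) (G.neighborSet x).toFinite
    have h₃ := Set.ncard_image_le (f := fe x) (G.neighborSet x).toFinite
    rw [Set.eq_univ_of_forall hall, Set.ncard_univ, Nat.card_fin] at h₁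
    unfold deg at hx
    omega
  simp only [Set.mem_union, Set.mem_image, SimpleGraph.mem_neighborSet, not_or, not_exists,
    not_and] at hc
  have hc₁ := hc.1
  have hc₂ := hc.2
  refine ⟨Function.update fv x c, h.symm, fun p q hp hq hpq => ?_, h.edge, fun p q hp hpq => ?_⟩
  · have := h.vertex p q
    have := hpq.symm
    have := hpq.ne
    simp only [Function.update_apply, Set.mem_insert_iff] at *
    grind
  · have := h.incident p q
    simp only [Function.update_apply, Set.mem_insert_iff] at *
    grind

/-- Some color occurs neither at a vertex of degree at most `κ - 2` nor on its incident edges. -/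
theorem exists_missing_color [Finite V] (G : SimpleGraph V) {κ : ℕ} {x : V}
    (fv : V → Fin κ) (fe : V → V → Fin κ) (hx : deg G x + 1 < κ) :
    ∃ c, fv x ≠ c ∧ ∀ q, G.Adj x q → fe x q ≠ c := by
  obtain ⟨c, hc⟩ : ∃ c, c ∉ insert (fv x) (fe x '' G.neighborSet x) := by
    by_contra! hall
    have h₁ := Set.ncard_insert_le (fv x) (fe x '' G.neighborSet x)
    have h₂ := Set.ncard_image_le (f := fe x) (G.neighborSet x).toFinite
    rw [Set.eq_univ_of_forall hall, Set.ncard_univ, Nat.card_fin] at h₁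
    unfold deg at hx
    omega
  simp only [Set.mem_insert_iff, Set.mem_image, SimpleGraph.mem_neighborSet, not_or, not_exists,
    not_and] at hc
  exact ⟨c, fun h => hc.1 h.symm, hc.2⟩

/-- Recolor the edge joining `p` and `q`. -/
def recolorEdge [DecidableEq V] {α : Type*} (fe : V → V → α) (p q : V) (c : α) : V → V → α :=
  fun x y => if x = p ∧ y = q ∨ x = q ∧ y = p then c else fe x y

/-- A color missing at both ends of an edge can be used to extend a coloring to this edge. -/
theorem IsPartialTotalColoring_s14.color_edge [DecidableEq V] {G H : SimpleGraph V} {α : Type*}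
    {S : Set V} {fv : V → α} {fe : V → V → α} {p q : V} {c : α}
    (h : IsPartialTotalColoring_s14 H S fv fe)
    (hGH : ∀ x y, G.Adj x y → H.Adj x y ∨ x = p ∧ y = q ∨ x = q ∧ y = p)
    (hp : ∀ r, H.Adj p r → fe p r ≠ c) (hq : ∀ r, H.Adj q r → fe q r ≠ c)
    (hpS : p ∈ S ∨ fv p ≠ c) (hqS : q ∈ S ∨ fv q ≠ c)
    (hv : p ∈ S ∨ q ∈ S ∨ fv p ≠ fv q) :
    IsPartialTotalColoring_s14 G S fv (recolorEdge fe p q c) where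
  symm x y := by
    have := h.symm x y
    grind [recolorEdge]
  vertex x y hx hy hxy := by
    have := h.vertex x y hx hy
    have := hGH x y hxy
    grind
  edge x y z hy hz hyz := by
    have := h.edge x y z
    have := hGH x y hy
    have := hGH x z hz
    grind [recolorEdge]
  incident x y hx hxy := by
    have := h.incident x y hx
    have := hGH x y hxy
    grind [recolorEdge]

/-- Suppose that an edge `vv₂` lies in two triangles, that `v₂` is uncolored of degree three, and
that `a` is missing at `v` and colors `v₁v₂`. Then the edges of the triangles can be recolored such
that a color other than `a` becomes missing at `v`. -/
theorem IsPartialTotalColoring_s14.exists_recolor_of_eq {H : SimpleGraph V} {α : Type*}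
    {fv : V → α} {fe : V → V → α} {S : Set V} {v v₁ v₂ v₃ : V} {a : α}
    (h : IsPartialTotalColoring_s14 H S fv fe) (hS : v₂ ∈ S) (hvS : v ∉ S)
    (h1 : H.Adj v v₁) (h2 : H.Adj v v₂) (h3 : H.Adj v v₃)
    (h12 : H.Adj v₁ v₂) (h23 : H.Adj v₂ v₃) (h13 : v₁ ≠ v₃)
    (hN : ∀ q, H.Adj v₂ q → q = v ∨ q = v₁ ∨ q = v₃)
    (ha : fv v ≠ a) (hae : ∀ q, H.Adj v q → fe v q ≠ a) (h12a : fe v₁ v₂ = a) :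
    ∃ fe' c, IsPartialTotalColoring_s14 H S fv fe' ∧ c ≠ a ∧ fv v ≠ c ∧
      (∀ q, H.Adj v q → fe' v q ≠ c) ∧
      ∀ p q, p ≠ v → p ≠ v₁ → p ≠ v₂ → p ≠ v₃ → fe' p q = fe p q := by
  classical
  have hs := h.symm
  have he := h.edge
  have hi := h.incident
  have n1 := h1.ne
  have n2 := h2.ne
  have n3 := h3.ne
  have n12 := h12.ne
  have n23 := h23.ne
  have e12 := he v v₁ v₂ h1 h2 n12
  have e13 := he v v₁ v₃ h1 h3 h13
  have e23 := he v v₂ v₃ h2 h3 n23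
  have f1 := he v₂ v v₁ h2.symm h12.symm n1
  have f3 := he v₂ v v₃ h2.symm h23 n3
  have f13 := he v₂ v₁ v₃ h12.symm h23 h13
  by_cases hxy : fe v v₁ = fe v₂ v₃
  · refine ⟨recolorEdge (recolorEdge (recolorEdge (recolorEdge fe v v₁ a) v₁ v₂ (fe v v₁))
      v v₃ (fe v v₁)) v₂ v₃ (fe v v₃), fe v v₃, ⟨?_, h.vertex, ?_, ?_⟩, hae v₃ h3, hi v v₃ hvS h3,
      ?_, ?_⟩
    · intro p q
      have := hs p q
      grind [recolorEdge]
    · intro p q r hq hr hqr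
      have := he p q r hq hr hqr
      by_cases hpv : p = v
      · subst hpv
        have := hae q hq
        have := hae r hr
        have := he p q v₁ hq h1
        have := he p r v₁ hr h1
        simp only [recolorEdge]
        grind
      by_cases hp1 : p = v₁
      · subst hp1
        have := he p q v hq h1.symm
        have := he p r v hr h1.symm
        have := he p q v₂ hq h12
        have := he p r v₂ hr h12
        simp only [recolorEdge]
        grind
      by_cases hp2 : p = v₂
      · subst hp2
        have := hN q hq
        have := hN r hr
        simp only [recolorEdge]
        grind
      by_cases hp3 : p = v₃
      · subst hp3
        have := he p q v hq h3.symm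
        have := he p r v hr h3.symm
        have := he p q v₂ hq h23.symm
        have := he p r v₂ hr h23.symm
        simp only [recolorEdge]
        grind
      simpa [recolorEdge, hpv, hp1, hp2, hp3] using this
    · intro p q hp hq
      have := hi p q hp hq
      have := hi p v hp
      have := hi p v₂ hp
      simp only [recolorEdge]
      grind [h1.symm, h3.symm, h23.symm]
    · intro q hq
      have := he v q v₃ hq h3
      have := hae v₃ h3
      simp only [recolorEdge]
      grind
    · intro p q hpv hp1 hp2 hp3
      simp [recolorEdge, hpv, hp1, hp2, hp3]
  · refine ⟨recolorEdge (recolorEdge fe v v₁ a) v₁ v₂ (fe v v₁), fe v v₁, ⟨?_, h.vertex, ?_, ?_⟩,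
      hae v₁ h1, hi v v₁ hvS h1, ?_, ?_⟩
    · intro p q
      have := hs p q
      grind [recolorEdge]
    · intro p q r hq hr hqr
      have := he p q r hq hr hqr
      by_cases hpv : p = v
      · subst hpv
        have := hae q hq
        have := hae r hr
        simp only [recolorEdge]
        grind
      by_cases hp1 : p = v₁
      · subst hp1
        have := he p q v hq h1.symm
        have := he p r v hr h1.symm
        have := he p q v₂ hq h12
        have := he p r v₂ hr h12
        simp only [recolorEdge]
        grind
      by_cases hp2 : p = v₂
      · subst hp2
        have := hN q hq
        have := hN r hr
        simp only [recolorEdge]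
        grind
      simpa [recolorEdge, hpv, hp1, hp2] using this
    · intro p q hp hq
      have := hi p q hp hq
      have := hi p v hp
      have := hi p v₂ hp
      simp only [recolorEdge]
      grind [h1.symm]
    · intro q hq
      have := he v q v₁ hq h1
      have := hae v₁ h1
      simp only [recolorEdge]
      grind
    · intro p q hpv hp1 hp2 _
      simp [recolorEdge, hpv, hp1, hp2]

/-- Suppose that an edge `vv₂` lies in two triangles, that `v₂` is uncolored of degree three, and
that `a` is missing at `v`. Then the edges of the triangles can be recolored such that a color other
than `a` becomes missing at `v`. -/
theorem IsPartialTotalColoring_s14.exists_recolor {H : SimpleGraph V} {α : Type*}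
    {fv : V → α} {fe : V → V → α} {S : Set V} {v v₁ v₂ v₃ : V} {a : α}
    (h : IsPartialTotalColoring_s14 H S fv fe) (hS : v₂ ∈ S) (hvS : v ∉ S)
    (h1 : H.Adj v v₁) (h2 : H.Adj v v₂) (h3 : H.Adj v v₃)
    (h12 : H.Adj v₁ v₂) (h23 : H.Adj v₂ v₃) (h13 : v₁ ≠ v₃)
    (hN : ∀ q, H.Adj v₂ q → q = v ∨ q = v₁ ∨ q = v₃)
    (ha : fv v ≠ a) (hae : ∀ q, H.Adj v q → fe v q ≠ a) :
    ∃ fe' c, IsPartialTotalColoring_s14 H S fv fe' ∧ c ≠ a ∧ fv v ≠ c ∧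
      (∀ q, H.Adj v q → fe' v q ≠ c) ∧
      ∀ p q, p ≠ v → p ≠ v₁ → p ≠ v₂ → p ≠ v₃ → fe' p q = fe p q := by
  classical
  by_cases h12a : fe v₁ v₂ = a
  · exact h.exists_recolor_of_eq hS hvS h1 h2 h3 h12 h23 h13 hN ha hae h12a
  by_cases h23a : fe v₃ v₂ = a
  · obtain ⟨fe', c, hP, hca, hvc, hec, heq⟩ := h.exists_recolor_of_eq hS hvS h3 h2 h1 h23.symm
      h12.symm h13.symm (fun q hq => by have := hN q hq; tauto) ha hae h23a
    exact ⟨fe', c, hP, hca, hvc, hec, fun p q hv hp1 hp2 hp3 => heq p q hv hp3 hp2 hp1⟩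
  have hs := h.symm
  have n2 := h2.ne
  refine ⟨recolorEdge fe v v₂ a, fe v v₂, ?_, hae v₂ h2, h.incident v v₂ hvS h2, ?_, ?_⟩
  · refine ⟨?_, h.vertex, ?_, ?_⟩
    · intro p q
      have := hs p q
      grind [recolorEdge]
    · intro p q r hq hr hqr
      have := h.edge p q r hq hr hqr
      by_cases hpv : p = v
      · subst hpv
        have := hae q hq
        have := hae r hr
        simp only [recolorEdge]
        grind
      by_cases hp2 : p = v₂
      · subst hp2
        have := hN q hq
        have := hN r hr
        simp only [recolorEdge]
        grind
      simpa [recolorEdge, hpv, hp2] using this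
    · intro p q hp hq
      have := h.incident p q hp hq
      simp only [recolorEdge]
      grind
  · intro q hq
    have := h.edge v q v₂ hq h2
    have := hae v₂ h2
    simp only [recolorEdge]
    grind
  · intro p q hpv _ hp2 _
    simp [recolorEdge, hpv, hp2]

theorem HasTotalColoring.mono {G : SimpleGraph V} {m n : ℕ} (h : HasTotalColoring G m)
    (hmn : m ≤ n) : HasTotalColoring G n := by
  obtain ⟨fv, fe, h₁, h₂, h₃⟩ := h
  have hinj := Fin.castLE_injective hmn
  exact ⟨fun x => Fin.castLE hmn (fv x), fun e => Fin.castLE hmn (fe e),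
    fun x y hxy => hinj.ne (h₁ x y hxy), fun e f he hf hne hw => hinj.ne (h₂ e f he hf hne hw),
    fun x e he hx => hinj.ne (h₃ x e he hx)⟩

theorem exists_hasTotalColoring [Finite V] (G : SimpleGraph V) : ∃ n, HasTotalColoring G n := by
  obtain ⟨n, ⟨f⟩⟩ := Finite.exists_equiv_fin (V ⊕ Sym2 V)
  exact ⟨n, fun x => f (.inl x), fun e => f (.inr e), fun x y hxy => by simpa using hxy.ne,
    fun e₁ e₂ _ _ hne _ => by simpa using hne, fun x e _ _ => by simp⟩

theorem totalChromaticNumber_le_iff [Finite V] {G : SimpleGraph V} {n : ℕ} :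
    totalChromaticNumber G ≤ n ↔ HasTotalColoring G n :=
  ⟨fun h => HasTotalColoring.mono (Nat.sInf_mem (exists_hasTotalColoring G)) h,
    fun h => Nat.sInf_le h⟩


/-- for κ ≥ 7, in a κ-deletion-minimal graph, if `v` is adjacent to a
2-vertex `u` not lying in any triangle, and `vv₂` lies in the two triangles
`vv₁v₂` and `vv₂v₃`, then `deg v₂ ≠ 3`. -/
theorem stmt_14 {V : Type*} [Fintype V] (κ : ℕ) (hκ : 7 ≤ κ) (G : SimpleGraph V)
    (hG : DeletionMinimal κ G) (v u v₁ v₂ v₃ : V)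
    (hdist : u ≠ v₁ ∧ u ≠ v₂ ∧ u ≠ v₃ ∧ v₁ ≠ v₂ ∧ v₁ ≠ v₃ ∧ v₂ ≠ v₃)
    (hu : G.Adj v u) (hu2 : deg G u = 2)
    (hunt : ¬ ∃ x y : V, G.Adj u x ∧ G.Adj u y ∧ G.Adj x y)
    (h1 : G.Adj v v₁) (h2 : G.Adj v v₂) (h3 : G.Adj v v₃)
    (h12 : G.Adj v₁ v₂) (h23 : G.Adj v₂ v₃) :
    deg G v₂ ≠ 3 := by
  classical
  intro hd
  obtain ⟨hu1, hu2', hu3, h12n, h13, h23n⟩ := hdist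
  obtain ⟨hdeg, hlt, hmin⟩ := hG
  have hN : ∀ q, G.Adj v₂ q → q = v ∨ q = v₁ ∨ q = v₃ := by
    have hsub : ({v, v₁, v₃} : Set V) ⊆ G.neighborSet v₂ := by
      rintro q (rfl | rfl | rfl)
      exacts [h2.symm, h12.symm, h23]
    have hcard : ({v, v₁, v₃} : Set V).ncard = 3 :=
      Set.ncard_eq_three.2 ⟨v, v₁, v₃, h1.ne, h3.ne, h13, rfl⟩
    have heq := Set.eq_of_subset_of_ncard_le hsub (by rw [hcard]; exact hd.le)
    intro q hq
    have hq' : q ∈ G.neighborSet v₂ := hq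
    simpa [← heq] using hq'
  obtain ⟨w, hw⟩ : ∃ w, ∀ q, G.Adj u q → q = v ∨ q = w := by
    obtain ⟨x, y, -, hxy⟩ := Set.ncard_eq_two.1 hu2
    have hmem : ∀ q, G.Adj u q ↔ q = x ∨ q = y := fun q => by
      rw [← SimpleGraph.mem_neighborSet, hxy]; simp
    rcases (hmem v).1 hu.symm with rfl | rfl
    · exact ⟨y, fun q hq => (hmem q).1 hq⟩
    · exact ⟨x, fun q hq => ((hmem q).1 hq).symm⟩
  set H := G.deleteEdges {s(v, u)} with hHdef
  have hH : ∀ x y, H.Adj x y ↔ G.Adj x y ∧ ¬(x = v ∧ y = u ∨ x = u ∧ y = v) := by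
    intro x y
    simp [hHdef, SimpleGraph.deleteEdges_adj]
  have hHG : H ≤ G := fun x y hxy => ((hH x y).1 hxy).1
  have hHlt : H < G := lt_of_le_of_ne hHG fun heq => by
    have := (hH v u).1 (heq ▸ hu)
    simp at this
  obtain ⟨fv, fe, hf⟩ := totalChromaticNumber_le_iff.1 (hmin H hHlt)
  have hP := hf.isPartialTotalColoring_s14 {v₂, u}
  have hv2u : v ∉ ({v₂, u} : Set V) := by simp [h2.ne, hu.ne]
  have hdegH : deg H v + 1 < κ := by
    have hlt' : deg H v < deg G v := by
      refine Set.ncard_lt_ncard ⟨fun q hq => hHG hq, fun hsub => ?_⟩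
      have := (hH v u).1 (hsub hu)
      simp at this
    have := hdeg v
    omega
  -- The edge `vu` can be colored if some color missing at `v` does not occur at `u`.
  suffices hext : ∃ fe' c, IsPartialTotalColoring_s14 H {v₂, u} fv fe' ∧ fv v ≠ c ∧
      (∀ q, H.Adj v q → fe' v q ≠ c) ∧ ∀ r, H.Adj u r → fe' u r ≠ c by
    obtain ⟨fe', c, hP', hvc, hev, heu⟩ := hext
    have hG' := hP'.color_edge (G := G) (p := v) (q := u)
      (fun x y hxy => by rw [hH]; tauto) hev heu (.inr hvc) (.inl (by simp)) (.inr (.inl (by simp)))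
    obtain ⟨fv₁, hG₁⟩ := hG'.exists_color_vertex (by omega)
    rw [← insert_empty_eq] at hG₁
    obtain ⟨fv₂, hG₂⟩ := hG₁.exists_color_vertex (by omega)
    obtain ⟨fe'', hG₃⟩ := hG₂.exists_isTotalColoring
    exact hlt.not_ge (totalChromaticNumber_le_iff.2 ⟨fv₂, fe'', hG₃⟩)
  have hHw : ∀ r, H.Adj u r → r = w := fun r hr => by
    have := hw r (hHG hr)
    have := (hH u r).1 hr
    tauto
  obtain ⟨a, hva, hea⟩ := exists_missing_color H fv (fun p q => fe s(p, q)) hdegH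
  by_cases haw : fe s(u, w) = a
  · obtain ⟨fe', c, hP', hca, hvc, hec, heq⟩ := hP.exists_recolor (by simp) hv2u
      ((hH v v₁).2 ⟨h1, by grind⟩) ((hH v v₂).2 ⟨h2, by grind⟩) ((hH v v₃).2 ⟨h3, by grind⟩)
      ((hH v₁ v₂).2 ⟨h12, by grind⟩) ((hH v₂ v₃).2 ⟨h23, by grind⟩) h13
      (fun q hq => hN q (hHG hq)) hva hea
    refine ⟨fe', c, hP', hvc, hec, fun r hr => ?_⟩
    rw [heq u r hu.ne' hu1 hu2' hu3, hHw r hr, haw]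
    exact hca.symm
  · exact ⟨_, a, hP, hva, hea, fun r hr => by rwa [hHw r hr]⟩
end
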